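/- Let G be a finite group and A a separable C*-algebra. Let α⁰, α¹ : G → Aut(A) be two actions with the Rokhlin property, and suppose there exists an automorphism ψ of A such that α¹_g is approximately unitarily equivalent to ψ ∘ α⁰_g ∘ ψ⁻¹ for every g ∈ G. Then α⁰ and α¹ are conjugate, i.e. there exists θ ∈ Aut(A) with α¹_g = θ ∘ α⁰_g ∘ θ⁻¹ for all g ∈ G. -/

import Mathlib

open Filter Topology

/-- Two maps `f g : A → B` into a (possibly non-unital) C⋆-algebra `B` are approximately
unitarily equivalent if there is a sequence of unitaries in the minimal unitalization of `B`
conjugating `f` to `g` pointwise in norm. -/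
def ApproxUnitarilyEquiv {A B : Type*} [NonUnitalCStarAlgebra B] (f g : A → B) : Prop :=
  ∃ u : ℕ → unitary (Unitization ℂ B), ∀ a : A,
    Tendsto
      (fun n => ‖(u n : Unitization ℂ B) * (f a : Unitization ℂ B) * star (u n : Unitization ℂ B)
        - (g a : Unitization ℂ B)‖) atTop (𝓝 0)

/-- `α : G → Aut(A)` is an honest group action (a homomorphism into the automorphism group). -/
def IsAction {G A : Type*} [Group G] [NonUnitalCStarAlgebra A] (α : G → A ≃⋆ₐ[ℂ] A) : Prop :=
  ∀ g h : G, ∀ a : A, α (g * h) a = α g (α h a)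

/-- The Rokhlin property for an action of a finite group `G` on a C⋆-algebra `A`. -/
def RokhlinProperty {G A : Type*} [Group G] [Fintype G] [NonUnitalCStarAlgebra A]
    [PartialOrder A] [StarOrderedRing A] (α : G → A ≃⋆ₐ[ℂ] A) : Prop :=
  ∀ ε > (0 : ℝ), ∀ F : Finset A, ∃ a : G → A,
    (∀ g, 0 ≤ a g) ∧ (∀ g, ‖a g‖ ≤ 1) ∧
    (∀ x ∈ F, ‖(∑ g : G, a g) * x - x‖ ≤ ε) ∧
    (∀ g h : G, ∀ x ∈ F, ‖(α g) (a h) * x - a (g * h) * x‖ ≤ ε) ∧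
    (∀ g h : G, g ≠ h → ∀ x ∈ F, ‖a g * a h * x‖ ≤ ε) ∧
    (∀ g : G, ∀ x ∈ F, ‖a g * x - x * a g‖ ≤ ε)

section InnerAutomorphisms

variable {A : Type*} [NonUnitalCStarAlgebra A]

theorem inr_snd_of_fst_eq_zero {A : Type*} [AddMonoid A]
    {x : Unitization ℂ A} (hx : x.fst = 0) : ((x.snd : A) : Unitization ℂ A) = x :=
  Unitization.ext (by simp [hx]) (by simp)

theorem inr_snd_unitary_conj (u : unitary (Unitization ℂ A)) (a : A) :
    (((u * a * star u : Unitization ℂ A).snd : A) : Unitization ℂ A) = u * a * star u :=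
  inr_snd_of_fst_eq_zero (by simp)

/-- Conjugation by a unitary of the minimal unitalization, as an automorphism of the algebra. -/
noncomputable def innerAut (u : unitary (Unitization ℂ A)) : A ≃⋆ₐ[ℂ] A where
  toFun a := (u * a * star u : Unitization ℂ A).snd
  invFun a := ((star u : unitary (Unitization ℂ A)) * a * star (star u : unitary _) :
    Unitization ℂ A).snd
  left_inv a := by
    apply Unitization.inr_injective (R := ℂ)
    rw [inr_snd_unitary_conj, inr_snd_unitary_conj]
    simp [mul_assoc]
    simp [← mul_assoc]
  right_inv a := by
    apply Unitization.inr_injective (R := ℂ)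
    rw [inr_snd_unitary_conj, inr_snd_unitary_conj]
    simp [mul_assoc]
    simp [← mul_assoc]
  map_add' a b := by simp [mul_add, add_mul]
  map_mul' a b := by
    apply Unitization.inr_injective (R := ℂ)
    rw [inr_snd_unitary_conj, Unitization.inr_mul, Unitization.inr_mul, inr_snd_unitary_conj,
      inr_snd_unitary_conj]
    simp only [mul_assoc]
    rw [← mul_assoc ((star u : unitary (Unitization ℂ A)) : Unitization ℂ A) u]
    simp
  map_star' a := by
    apply Unitization.inr_injective (R := ℂ)
    rw [inr_snd_unitary_conj, Unitization.inr_star, Unitization.inr_star, inr_snd_unitary_conj]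
    simp [mul_assoc]
  map_smul' c a := by simp

theorem inr_innerAut (u : unitary (Unitization ℂ A)) (a : A) :
    ((innerAut u a : A) : Unitization ℂ A) = u * a * star (u : Unitization ℂ A) :=
  inr_snd_unitary_conj u a

theorem innerAut_mul (u v : unitary (Unitization ℂ A)) :
    innerAut (u * v) = innerAut u * innerAut v := by
  ext a
  apply Unitization.inr_injective (R := ℂ)
  rw [StarAlgEquiv.mul_apply]
  simp [inr_innerAut, mul_assoc]

variable (A) in
/-- The subgroup of automorphisms implemented by unitaries of the minimal unitalization. -/
noncomputable def innerAutSubgroup : Subgroup (A ≃⋆ₐ[ℂ] A) :=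
  (MonoidHom.mk' (innerAut (A := A)) innerAut_mul).range

theorem mem_innerAutSubgroup {σ : A ≃⋆ₐ[ℂ] A} :
    σ ∈ innerAutSubgroup A ↔ ∃ u, innerAut u = σ := Iff.rfl

instance innerAutSubgroup_normal : (innerAutSubgroup A).Normal := by
  refine ⟨fun σ hσ φ => ?_⟩
  obtain ⟨u, rfl⟩ := mem_innerAutSubgroup.1 hσ
  let Φ : Unitization ℂ A →⋆ₐ[ℂ] Unitization ℂ A :=
    Unitization.starMap (φ : A →⋆ₙₐ[ℂ] A)
  refine mem_innerAutSubgroup.2 ⟨⟨Φ u, Unitary.mem_iff.2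
    ⟨by rw [← map_star, ← map_mul]; simp, by rw [← map_star, ← map_mul]; simp⟩⟩, ?_⟩
  · ext a
    apply Unitization.inr_injective (R := ℂ)
    obtain ⟨b, rfl⟩ : ∃ b, φ b = a := φ.surjective a
    have h : ∀ c : A, ((φ c : A) : Unitization ℂ A) = Φ c := fun c => by simp [Φ]
    rw [StarAlgEquiv.mul_apply, StarAlgEquiv.mul_apply, inr_innerAut, h, h, inr_innerAut]
    have : (φ⁻¹) (φ b) = b := φ.symm_apply_apply b
    rw [this]
    simp [map_star]

theorem norm_aut (σ : A ≃⋆ₐ[ℂ] A) (a : A) : ‖σ a‖ = ‖a‖ :=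
  NonUnitalStarAlgHom.norm_map σ σ.injective a

end InnerAutomorphisms

theorem exists_unitary_norm_sub_le {B : Type*} [CStarAlgebra B] {w : B}
    (h₁ : ‖star w * w - 1‖ ≤ 1 / 2) (h₂ : ‖w * star w - 1‖ ≤ 1 / 2) :
    ∃ u : unitary B, ‖(u : B) - w‖ ≤ 2 * ‖star w * w - 1‖ := by
  nontriviality B
  set h := star w * w with hh
  have hsa : IsSelfAdjoint h := IsSelfAdjoint.star_mul_self w
  have hspec : ∀ x ∈ spectrum ℝ h, |x - 1| ≤ ‖h - 1‖ := by
    intro x hx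
    have : x - 1 ∈ spectrum ℝ (h - 1) := by
      have := spectrum.sub_singleton_eq h (1 : ℝ)
      rw [map_one] at this
      rw [← this]
      exact Set.sub_mem_sub hx rfl
    simpa using spectrum.norm_le_norm_of_mem this
  have hpos : ∀ x ∈ spectrum ℝ h, 1 / 2 ≤ x := fun x hx => by
    have := (hspec x hx).trans h₁
    rw [abs_le] at this; linarith
  have hne : ∀ x ∈ spectrum ℝ h, √x ≠ 0 := fun x hx =>
    (Real.sqrt_pos.2 (by linarith [hpos x hx])).ne'
  have hcont : ContinuousOn (fun x : ℝ => (√x)⁻¹) (spectrum ℝ h) :=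
    ContinuousOn.inv₀ Real.continuous_sqrt.continuousOn hne
  set c := cfc (fun x : ℝ => (√x)⁻¹) h with hc
  have hcsa : star c = c := (cfc_predicate (fun x : ℝ => (√x)⁻¹) h : IsSelfAdjoint c)
  have hcc : c * c * h = 1 := by
    calc c * c * h = c * c * cfc (fun x : ℝ => x) h := by rw [cfc_id' ℝ h]
      _ = cfc (fun x : ℝ => (√x)⁻¹ * (√x)⁻¹ * x) h := by
        rw [cfc_mul (fun x : ℝ => (√x)⁻¹ * (√x)⁻¹) (fun x => x) h (hcont.mul hcont)
          continuousOn_id, cfc_mul (fun x : ℝ => (√x)⁻¹) (fun x => (√x)⁻¹) h hcont hcont]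
      _ = cfc (fun _ : ℝ => (1 : ℝ)) h := by
        refine cfc_congr fun x hx => ?_
        have h0 := hne x hx
        have := Real.sq_sqrt (show 0 ≤ x by linarith [hpos x hx])
        field_simp
        exact this.symm
      _ = 1 := cfc_const_one ℝ h
  have hcomm : c * h = h * c := by
    have := (cfc_commute_cfc (fun x : ℝ => (√x)⁻¹) (fun x => x) h).eq
    rwa [cfc_id' ℝ h] at this
  have hc1 : ‖c - 1‖ ≤ ‖h - 1‖ := by
    have : c - 1 = cfc (fun x : ℝ => (√x)⁻¹ - 1) h := by
      rw [cfc_sub _ _ h hcont continuousOn_const, cfc_const_one ℝ h]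
    rw [this]
    refine norm_cfc_le (norm_nonneg _) fun x hx => ?_
    refine le_trans ?_ (hspec x hx)
    have h0 := hpos x hx
    have h2 := Real.sq_sqrt (show 0 ≤ x by linarith)
    have h3 : 7 / 10 ≤ √x := Real.le_sqrt_of_sq_le (by linarith)
    set s := √x
    have : s⁻¹ - 1 = (1 - x) / (s * (1 + s)) := by
      rw [← h2]; field_simp; ring
    simp only [Real.norm_eq_abs]
    rw [this, abs_div, abs_sub_comm, abs_of_pos (show 0 < s * (1 + s) by positivity)]
    exact div_le_self (abs_nonneg _) (by nlinarith)
  have hinv : w * (c * c * star w) = 1 := by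
    have hu : IsUnit (w * star w) := by
      have := isUnit_one_sub_of_norm_lt_one (x := 1 - w * star w)
        (by rw [norm_sub_rev]; linarith)
      simpa using this
    obtain ⟨v, hv⟩ := hu.exists_right_inv
    rw [mul_assoc] at hv
    have hl : (c * c * star w) * w = 1 := by rw [mul_assoc, ← hh, hcc]
    rw [left_inv_eq_right_inv hl hv, hv]
  have hwn : ‖w‖ ≤ 2 := by
    have h4 : ‖h‖ = ‖w‖ * ‖w‖ := CStarRing.norm_star_mul_self
    have h5 : ‖h‖ ≤ ‖h - 1‖ + ‖(1 : B)‖ := by simpa using norm_add_le (h - 1) 1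
    rw [CStarRing.norm_one] at h5
    nlinarith [norm_nonneg w]
  refine ⟨⟨w * c, ?_, ?_⟩, ?_⟩
  · rw [star_mul, hcsa, ← mul_assoc, mul_assoc c, ← hh, mul_assoc, ← hcomm, ← mul_assoc, hcc]
  · rw [star_mul, hcsa, ← hinv]; simp only [mul_assoc]
  · have : w * c - w = w * (c - 1) := by rw [mul_sub, mul_one]
    simp only [this]
    exact (norm_mul_le _ _).trans (mul_le_mul hwn hc1 (norm_nonneg _) (by norm_num))

section RokhlinNets

variable {G A ι : Type*} [Group G] [Fintype G] [NonUnitalCStarAlgebra A]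

/-- A bounded net of self-adjoint families that asymptotically satisfies the Rokhlin relations
on all of `A`. -/
structure IsRokhlinNet (α : G → A ≃⋆ₐ[ℂ] A) (l : Filter ι) (f : ι → G → A) : Prop where
  star_eq : ∀ i g, star (f i g) = f i g
  norm_le : ∀ i g, ‖f i g‖ ≤ 1
  sum_mul : ∀ x, Tendsto (fun i => (∑ g, f i g) * x - x) l (𝓝 0)
  shift : ∀ g h x, Tendsto (fun i => α g (f i h) * x - f i (g * h) * x) l (𝓝 0)
  orthogonal : ∀ g h, g ≠ h → ∀ x, Tendsto (fun i => f i g * f i h * x) l (𝓝 0)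
  commute : ∀ g x, Tendsto (fun i => f i g * x - x * f i g) l (𝓝 0)

theorem RokhlinProperty.exists_isRokhlinNet [PartialOrder A] [StarOrderedRing A]
    {α : G → A ≃⋆ₐ[ℂ] A} (hα : RokhlinProperty α) :
    ∃ f : ℕ × Finset A → G → A, IsRokhlinNet α atTop f := by
  classical
  have hε : ∀ n : ℕ, (0 : ℝ) < 1 / ((n : ℝ) + 1) := fun n => Nat.one_div_pos_of_nat
  choose f hf using fun p : ℕ × Finset A => hα (1 / ((p.1 : ℝ) + 1)) (hε p.1) p.2
  have hlim : Tendsto (fun p : ℕ × Finset A => 1 / ((p.1 : ℝ) + 1)) atTop (𝓝 0) := by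
    refine tendsto_one_div_add_atTop_nhds_zero_nat.comp ?_
    rw [← prod_atTop_atTop_eq]
    exact tendsto_fst
  have hmem : ∀ x : A, ∀ᶠ p : ℕ × Finset A in atTop, x ∈ p.2 := fun x =>
    (eventually_ge_atTop ((0, {x}) : ℕ × Finset A)).mono fun p hp => hp.2 (by simp)
  have key : ∀ (x : A) (F : ℕ × Finset A → A),
      (∀ p, x ∈ p.2 → ‖F p‖ ≤ 1 / ((p.1 : ℝ) + 1)) → Tendsto F atTop (𝓝 0) :=
    fun x F hF => squeeze_zero_norm' ((hmem x).mono hF) hlim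
  exact ⟨f, fun p g => ((hf p).1 g).isSelfAdjoint, fun p => (hf p).2.1,
    fun x => key x _ fun p hp => (hf p).2.2.1 x hp,
    fun g h x => key x _ fun p hp => (hf p).2.2.2.1 g h x hp,
    fun g h hgh x => key x _ fun p hp => (hf p).2.2.2.2.1 g h hgh x hp,
    fun g x => key x _ fun p hp => (hf p).2.2.2.2.2 g x hp⟩

theorem tendsto_mul_zero_of_norm_le {u v : ι → A} {l : Filter ι} {C : ℝ}
    (hu : ∀ i, ‖u i‖ ≤ C) (hv : Tendsto v l (𝓝 0)) :
    Tendsto (fun i => u i * v i) l (𝓝 0) :=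
  isBoundedUnder_le_mul_tendsto_zero ⟨C, by simpa using Eventually.of_forall hu⟩ hv

theorem tendsto_zero_mul_of_norm_le {u v : ι → A} {l : Filter ι} {C : ℝ}
    (hu : Tendsto u l (𝓝 0)) (hv : ∀ i, ‖v i‖ ≤ C) :
    Tendsto (fun i => u i * v i) l (𝓝 0) :=
  hu.zero_mul_isBoundedUnder_le ⟨C, by simpa using Eventually.of_forall hv⟩

namespace IsRokhlinNet

variable {α : G → A ≃⋆ₐ[ℂ] A} {l : Filter ι} {f : ι → G → A}

theorem mul_mul_mul_of_ne (R : IsRokhlinNet α l f) {g h : G} (hgh : g ≠ h) (b c : A) :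
    Tendsto (fun i => f i g * b * (f i h * c)) l (𝓝 0) := by
  have h₁ := tendsto_mul_zero_of_norm_le (fun i => R.norm_le i g)
    (show Tendsto _ l (𝓝 0) by simpa using (R.commute h b).mul_const c)
  have h₂ := (R.orthogonal g h hgh (b * c)).sub h₁
  simp only [sub_zero] at h₂
  exact h₂.congr fun i => by noncomm_ring

theorem sq_mul (R : IsRokhlinNet α l f) (g : G) (c : A) :
    Tendsto (fun i => f i g * f i g * c - f i g * c) l (𝓝 0) := by
  classical
  have h₁ := tendsto_mul_zero_of_norm_le (fun i => R.norm_le i g) (R.sum_mul c)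
  have h₂ := h₁.sub (tendsto_finsetSum (Finset.univ.erase g) fun h hh =>
    R.orthogonal g h (Finset.ne_of_mem_erase hh).symm c)
  simp only [Finset.sum_const_zero, sub_zero] at h₂
  refine h₂.congr fun i => ?_
  rw [← Finset.sum_mul, ← Finset.mul_sum, ← Finset.add_sum_erase _ _ (Finset.mem_univ g)]
  noncomm_ring

theorem mul_mul_mul_self (R : IsRokhlinNet α l f) (g : G) (b c : A) :
    Tendsto (fun i => f i g * b * (f i g * c) - f i g * (b * c)) l (𝓝 0) := by
  have h₁ := tendsto_mul_zero_of_norm_le (fun i => R.norm_le i g)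
    (show Tendsto _ l (𝓝 0) by simpa using (R.commute g b).mul_const c)
  have h₂ := (R.sq_mul g (b * c)).sub h₁
  simp only [sub_zero] at h₂
  exact h₂.congr fun i => by noncomm_ring

theorem sum_mul_sum (R : IsRokhlinNet α l f) (b c : G → A) :
    Tendsto (fun i => (∑ g, f i g * b g) * (∑ g, f i g * c g) - ∑ g, f i g * (b g * c g)) l
      (𝓝 0) := by
  classical
  have h₁ : Tendsto (fun i => ∑ g, ((f i g * b g * (f i g * c g) - f i g * (b g * c g)) +
      ∑ h ∈ Finset.univ.erase g, f i g * b g * (f i h * c h))) l (𝓝 0) := by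
    have := tendsto_finsetSum Finset.univ fun g _ => (R.mul_mul_mul_self g (b g) (c g)).add
      (tendsto_finsetSum (Finset.univ.erase g) fun h hh =>
        R.mul_mul_mul_of_ne (Finset.ne_of_mem_erase hh).symm (b g) (c h))
    simpa using this
  refine h₁.congr fun i => ?_
  rw [Finset.sum_mul_sum, ← Finset.sum_sub_distrib]
  refine Finset.sum_congr rfl fun g _ => ?_
  rw [← Finset.add_sum_erase _ _ (Finset.mem_univ g)]
  abel

theorem sum_const (R : IsRokhlinNet α l f) (x : A) :
    Tendsto (fun i => ∑ g, f i g * x - x) l (𝓝 0) := by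
  simpa only [← Finset.sum_mul] using R.sum_mul x

theorem norm_sum_le (R : IsRokhlinNet α l f) (b : G → A) (i : ι) :
    ‖∑ g, f i g * b g‖ ≤ ∑ g, ‖b g‖ :=
  norm_sum_le_of_le _ fun g _ => (norm_mul_le _ _).trans
    (mul_le_of_le_one_left (norm_nonneg _) (R.norm_le i g))

theorem star_sum (R : IsRokhlinNet α l f) (b : G → A) :
    Tendsto (fun i => star (∑ g, f i g * b g) - ∑ g, f i g * star (b g)) l (𝓝 0) := by
  have := (tendsto_finsetSum Finset.univ fun g _ => R.commute g (star (b g))).neg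
  simp only [Finset.sum_const_zero, neg_zero] at this
  refine this.congr fun i => ?_
  simp [R.star_eq]

theorem map_sum (R : IsRokhlinNet α l f) (h : G) (b : G → A) :
    Tendsto (fun i => α h (∑ g, f i g * b g) - ∑ g, f i (h * g) * α h (b g)) l (𝓝 0) := by
  have := tendsto_finsetSum Finset.univ fun g _ => R.shift h g (α h (b g))
  simp only [Finset.sum_const_zero] at this
  refine this.congr fun i => ?_
  simp [_root_.map_sum]

theorem quasiinverse (R : IsRokhlinNet α l f) {b c : G → A} (hbc : ∀ g, b g + c g + b g * c g = 0) :
    Tendsto (fun i => ∑ g, f i g * b g + ∑ g, f i g * c g +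
      (∑ g, f i g * b g) * ∑ g, f i g * c g) l (𝓝 0) := by
  refine (R.sum_mul_sum b c).congr fun i => ?_
  have : ∑ g, f i g * b g + ∑ g, f i g * c g + ∑ g, f i g * (b g * c g) = 0 := by
    simp only [← Finset.sum_add_distrib, ← mul_add, hbc, mul_zero, Finset.sum_const_zero]
  rw [← sub_zero ((_ + _) + _), ← this]
  abel

theorem conj_sum (R : IsRokhlinNet α l f) (b : G → A) (x : A) :
    Tendsto (fun i => (x + (∑ g, f i g * b g) * x + x * star (∑ g, f i g * b g)
      + (∑ g, f i g * b g) * x * star (∑ g, f i g * b g)) -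
      ∑ g, f i g * (x + b g * x + x * star (b g) + b g * x * star (b g))) l (𝓝 0) := by
  have h₀ := R.sum_const x
  have h₁ := tendsto_mul_zero_of_norm_le (u := fun _ => x) (fun i => le_rfl) (R.star_sum b)
  have h₂ := tendsto_zero_mul_of_norm_le h₀ (R.norm_sum_le (fun g => star (b g)))
  have h₃ := R.sum_mul_sum (fun _ => x) (fun g => star (b g))
  have h₄ := tendsto_mul_zero_of_norm_le (R.norm_sum_le (fun g => b g * x)) (R.star_sum b)
  have h₅ := R.sum_mul_sum (fun g => b g * x) (fun g => star (b g))
  have := (((h₁.sub h₂).add h₃).add (h₄.add h₅)).sub h₀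
  simp only [add_zero, sub_zero] at this
  refine this.congr fun i => ?_
  have hs : (∑ g, f i g * b g) * x = ∑ g, f i g * (b g * x) := by
    simp only [Finset.sum_mul, mul_assoc]
  simp only [hs, mul_add, Finset.sum_add_distrib]
  noncomm_ring

end IsRokhlinNet

end RokhlinNets

section UnitaryNets

variable {A : Type*} [NonUnitalCStarAlgebra A]

theorem exists_unitary_fst_eq_one (u : unitary (Unitization ℂ A)) :
    ∃ v : unitary (Unitization ℂ A), (v : Unitization ℂ A).fst = 1 ∧ innerAut v = innerAut u := by
  set z : ℂ := (u : Unitization ℂ A).fst with hz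
  have h₁ : star z * z = 1 := by
    have := congrArg (fun x : Unitization ℂ A => x.fst) (Unitary.coe_star_mul_self u)
    simpa only [Unitization.fst_mul, Unitization.fst_star, Unitization.fst_one] using this
  have h₂ : z * star z = 1 := by rw [mul_comm, h₁]
  refine ⟨⟨star z • (u : Unitization ℂ A), Unitary.mem_iff.2 ⟨?_, ?_⟩⟩, by simpa using h₁, ?_⟩
  · rw [star_smul, smul_mul_smul_comm, star_star, h₂]; simp
  · rw [star_smul, smul_mul_smul_comm, star_star, h₁]; simp
  · ext a
    apply Unitization.inr_injective (R := ℂ)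
    rw [inr_innerAut, inr_innerAut]
    simp only [star_smul, smul_mul_assoc, mul_smul_comm, smul_smul, star_star]
    rw [h₂, one_smul]

theorem eq_one_add_inr {w : Unitization ℂ A} (hw : w.fst = 1) : w = 1 + (w.snd : A) :=
  Unitization.ext (by simp [hw]) (by simp)

theorem star_mul_self_sub_one_eq (b : A) :
    star (1 + b : Unitization ℂ A) * (1 + b) - 1 = ((star b + b + star b * b : A) :) := by
  simp only [Unitization.inr_add, Unitization.inr_mul, Unitization.inr_star, star_add, star_one]
  noncomm_ring

theorem mul_star_self_sub_one_eq (b : A) :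
    (1 + b : Unitization ℂ A) * star (1 + b : Unitization ℂ A) - 1 =
      ((b + star b + b * star b : A) :) := by
  simp only [Unitization.inr_add, Unitization.inr_mul, Unitization.inr_star, star_add, star_one]
  noncomm_ring

theorem one_add_mul_star_one_add (b x : A) :
    (1 + b : Unitization ℂ A) * x * star (1 + b : Unitization ℂ A) =
      ((x + b * x + x * star b + b * x * star b : A) :) := by
  simp only [Unitization.inr_add, Unitization.inr_mul, Unitization.inr_star, star_add, star_one]
  noncomm_ring

theorem exists_unitary_tendsto {ι B : Type*} [CStarAlgebra B] {l : Filter ι} {w : ι → B}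
    (h₁ : Tendsto (fun i => star (w i) * w i - 1) l (𝓝 0))
    (h₂ : Tendsto (fun i => w i * star (w i) - 1) l (𝓝 0)) :
    ∃ u : ι → unitary B, Tendsto (fun i => (u i : B) - w i) l (𝓝 0) := by
  classical
  have key : ∀ i, ∃ u : unitary B, ‖star (w i) * w i - 1‖ ≤ 1 / 2 → ‖w i * star (w i) - 1‖ ≤ 1 / 2 →
      ‖(u : B) - w i‖ ≤ 2 * ‖star (w i) * w i - 1‖ := fun i => by
    by_cases h : ‖star (w i) * w i - 1‖ ≤ 1 / 2 ∧ ‖w i * star (w i) - 1‖ ≤ 1 / 2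
    · obtain ⟨u, hu⟩ := exists_unitary_norm_sub_le h.1 h.2
      exact ⟨u, fun _ _ => hu⟩
    · exact ⟨1, fun h₁ h₂ => (h ⟨h₁, h₂⟩).elim⟩
  choose u hu using key
  have e₁ := (tendsto_zero_iff_norm_tendsto_zero.1 h₁)
  have e₂ := (tendsto_zero_iff_norm_tendsto_zero.1 h₂)
  refine ⟨u, squeeze_zero_norm' ?_ (by simpa using e₁.const_mul 2)⟩
  filter_upwards [e₁.eventually_le_const (show (0 : ℝ) < 1 / 2 by norm_num),
    e₂.eventually_le_const (show (0 : ℝ) < 1 / 2 by norm_num)] with i hi₁ hi₂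
  exact hu i hi₁ hi₂

theorem IsRokhlinNet.exists_unitary {G ι : Type*} [Group G] [Fintype G]
    {α : G → A ≃⋆ₐ[ℂ] A} {l : Filter ι} {f : ι → G → A} (R : IsRokhlinNet α l f)
    (u : G → unitary (Unitization ℂ A)) :
    ∃ w : ι → unitary (Unitization ℂ A), ∀ x : A,
      Tendsto (fun i => innerAut (w i) x - ∑ g, f i g * innerAut (u g) x) l (𝓝 0) := by
  choose v hv huv using fun g => exists_unitary_fst_eq_one (u g)
  set b : G → A := fun g => (v g : Unitization ℂ A).snd
  have hvb : ∀ g, (v g : Unitization ℂ A) = 1 + (b g : A) := fun g => eq_one_add_inr (hv g)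
  have hb₁ : ∀ g, star (b g) + b g + star (b g) * b g = 0 := fun g => by
    apply Unitization.inr_injective (R := ℂ)
    rw [← star_mul_self_sub_one_eq, ← hvb]; simp
  have hb₂ : ∀ g, b g + star (b g) + b g * star (b g) = 0 := fun g => by
    apply Unitization.inr_injective (R := ℂ)
    rw [← mul_star_self_sub_one_eq, ← hvb]; simp
  have hu : ∀ g x, innerAut (u g) x = x + b g * x + x * star (b g) + b g * x * star (b g) :=
    fun g x => by
      apply Unitization.inr_injective (R := ℂ)
      rw [← huv, inr_innerAut, ← one_add_mul_star_one_add, ← hvb]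
  set S : ι → A := fun i => ∑ g, f i g * b g
  have hinr : ∀ {F : ι → A}, Tendsto F l (𝓝 0) →
      Tendsto (fun i => (F i : Unitization ℂ A)) l (𝓝 0) := fun hF => by
    rw [tendsto_zero_iff_norm_tendsto_zero] at hF ⊢
    simpa only [Unitization.norm_inr] using hF
  have hS := R.star_sum b
  have h₁ : Tendsto (fun i => star (S i) + S i + star (S i) * S i) l (𝓝 0) := by
    have := (R.quasiinverse hb₁).add
      (hS.add (tendsto_zero_mul_of_norm_le hS (R.norm_sum_le b)))
    simp only [add_zero] at this
    refine this.congr fun i => ?_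
    simp only [S]
    noncomm_ring
  have h₂ : Tendsto (fun i => S i + star (S i) + S i * star (S i)) l (𝓝 0) := by
    have := (R.quasiinverse hb₂).add
      (hS.add (tendsto_mul_zero_of_norm_le (R.norm_sum_le b) hS))
    simp only [add_zero] at this
    refine this.congr fun i => ?_
    simp only [S]
    noncomm_ring
  obtain ⟨w, hw⟩ := exists_unitary_tendsto (w := fun i => 1 + (S i : Unitization ℂ A))
    ((hinr h₁).congr fun i => (star_mul_self_sub_one_eq _).symm)
    ((hinr h₂).congr fun i => (mul_star_self_sub_one_eq _).symm)
  refine ⟨w, fun x => ?_⟩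
  have hwn : ∀ i, ‖((w i : Unitization ℂ A) * x)‖ ≤ ‖x‖ := fun i => by
    rw [CStarRing.norm_coe_unitary_mul, Unitization.norm_inr]
  have hsn : ∀ i, ‖(x * star (1 + (S i : Unitization ℂ A)))‖ ≤ ‖x‖ * (‖(1 : Unitization ℂ A)‖
      + ∑ g, ‖b g‖) := fun i => by
    refine (norm_mul_le _ _).trans ?_
    rw [Unitization.norm_inr, norm_star]
    gcongr
    refine (norm_add_le _ _).trans ?_
    rw [Unitization.norm_inr]
    gcongr
    exact R.norm_sum_le b i
  have h₃ : Tendsto (fun i => star ((w i : Unitization ℂ A) - (1 + (S i : Unitization ℂ A)))) l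
      (𝓝 0) := by simpa using hw.star
  have h₄ := (tendsto_mul_zero_of_norm_le hwn h₃).add (tendsto_zero_mul_of_norm_le hw hsn)
  have h₅ := h₄.add (hinr (R.conj_sum b x))
  simp only [add_zero] at h₅
  have h₆ : Tendsto (fun i => ((innerAut (w i) x - ∑ g, f i g * innerAut (u g) x : A) :
      Unitization ℂ A)) l (𝓝 0) := by
    refine h₅.congr fun i => ?_
    simp only [hu]
    rw [Unitization.inr_sub, Unitization.inr_sub, inr_innerAut, ← one_add_mul_star_one_add]
    simp only [S, star_sub]
    noncomm_ring
  rw [tendsto_zero_iff_norm_tendsto_zero] at h₆ ⊢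
  simpa only [Unitization.norm_inr] using h₆

end UnitaryNets

section AlmostEquivariance

variable {G A : Type*} [NonUnitalCStarAlgebra A]

theorem IsAction.map_one [Group G] {α : G → A ≃⋆ₐ[ℂ] A} (hα : IsAction α) (a : A) : α 1 a = a :=
  (α 1).injective (show α 1 (α 1 a) = α 1 a by rw [← hα, mul_one])

theorem IsAction.apply_inv [Group G] {α : G → A ≃⋆ₐ[ℂ] A} (hα : IsAction α) (g : G) (a : A) :
    α g (α g⁻¹ a) = a := by
  rw [← hα, mul_inv_cancel, hα.map_one]

theorem norm_aut_sub (σ : A ≃⋆ₐ[ℂ] A) (a b : A) : ‖σ a - σ b‖ = ‖a - b‖ := by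
  rw [← map_sub, norm_aut]

theorem aut_inv_apply_self (σ : A ≃⋆ₐ[ℂ] A) (a : A) : σ⁻¹ (σ a) = a := σ.symm_apply_apply a

theorem aut_apply_inv_self (σ : A ≃⋆ₐ[ℂ] A) (a : A) : σ (σ⁻¹ a) = a := σ.apply_symm_apply a

/-- For every `g`, the automorphisms `φ ∘ α g` and `β g ∘ φ` agree up to inner automorphisms,
approximately on finite sets. -/
def ApproxInnerEquivariant (α β : G → A ≃⋆ₐ[ℂ] A) (φ : A ≃⋆ₐ[ℂ] A) : Prop :=
  ∀ (g : G) (F : Finset A), ∀ ε > (0 : ℝ), ∃ σ ∈ innerAutSubgroup A,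
    ∀ x ∈ F, ‖σ (φ (α g x)) - β g (φ x)‖ ≤ ε

/-- The automorphism `φ` intertwines `α` and `β` on `F` up to `δ`. -/
def AlmostEquivariant (α β : G → A ≃⋆ₐ[ℂ] A) (φ : A ≃⋆ₐ[ℂ] A) (F : Finset A) (δ : ℝ) : Prop :=
  ∀ (g : G), ∀ x ∈ F, ‖β g (φ x) - φ (α g x)‖ ≤ δ

variable {α β : G → A ≃⋆ₐ[ℂ] A} {φ : A ≃⋆ₐ[ℂ] A}

theorem ApproxInnerEquivariant.inv (h : ApproxInnerEquivariant α β φ) :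
    ApproxInnerEquivariant β α φ⁻¹ := by
  classical
  intro g F ε hε
  obtain ⟨σ, hσ, hF⟩ := h g (F.image ⇑(φ⁻¹)) ε hε
  refine ⟨φ⁻¹ * σ⁻¹ * φ⁻¹⁻¹, innerAutSubgroup_normal.conj_mem _ (inv_mem hσ) _, fun y hy => ?_⟩
  have := hF _ (Finset.mem_image_of_mem _ hy)
  rw [aut_apply_inv_self] at this
  rw [← norm_aut_sub (σ * φ), norm_sub_rev]
  simpa only [StarAlgEquiv.mul_apply, aut_apply_inv_self, inv_inv] using this

theorem ApproxInnerEquivariant.inner_mul (h : ApproxInnerEquivariant α β φ)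
    {τ : A ≃⋆ₐ[ℂ] A} (hτ : τ ∈ innerAutSubgroup A) :
    ApproxInnerEquivariant α β (τ * φ) := by
  intro g F ε hε
  obtain ⟨σ, hσ, hF⟩ := h g F ε hε
  refine ⟨(β g * τ * (β g)⁻¹) * σ * τ⁻¹, mul_mem (mul_mem
    (innerAutSubgroup_normal.conj_mem _ hτ _) hσ) (inv_mem hτ), fun x hx => ?_⟩
  simp only [StarAlgEquiv.mul_apply, aut_inv_apply_self]
  rw [norm_aut_sub, norm_aut_sub, ← norm_aut_sub (β g), aut_apply_inv_self]
  exact hF x hx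

variable [Group G] [Fintype G]

theorem ApproxInnerEquivariant.exists_inner {ι : Type*} {l : Filter ι} [l.NeBot]
    {f : ι → G → A} (hα : IsAction α) (hβ : IsAction β) (R : IsRokhlinNet β l f)
    (h : ApproxInnerEquivariant α β φ) (F : Finset A) {ε : ℝ} (hε : 0 < ε) :
    ∃ σ ∈ innerAutSubgroup A, AlmostEquivariant α β (σ * φ) F ε ∧
      ∀ x ∈ F, ‖σ (φ x) - φ x‖ ≤ ε + ∑ g, ‖β g (φ (α g⁻¹ x)) - φ x‖ := by
  classical
  set N : ℝ := (Fintype.card G : ℝ) with hN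
  have hN0 : 0 < N := by rw [hN]; exact_mod_cast Fintype.card_pos
  set ε' : ℝ := ε / (8 * N) with hε'
  have hε'0 : 0 < ε' := by positivity
  have hNε : N * ε' = ε / 8 := by rw [hε']; field_simp
  set F' : Finset A := (Finset.univ ×ˢ F).image fun p : G × A => α p.1 p.2
  have hF' : ∀ g, ∀ x ∈ F, α g x ∈ F' := fun g x hx =>
    Finset.mem_image.2 ⟨(g, x), by simpa using hx, rfl⟩
  have hFF' : ∀ x ∈ F, x ∈ F' := fun x hx => by simpa [hα.map_one] using hF' 1 x hx
  choose σ hσ hσF using fun g => h g (F'.image (α g⁻¹)) ε' hε'0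
  choose u hu using fun g => mem_innerAutSubgroup.1 (hσ g)
  have hT : ∀ g, ∀ y ∈ F', ‖innerAut (u g) (φ y) - β g (φ (α g⁻¹ y))‖ ≤ ε' := fun g y hy => by
    have := hσF g _ (Finset.mem_image_of_mem _ hy)
    rwa [hα.apply_inv, ← hu] at this
  obtain ⟨w, hw⟩ := R.exists_unitary u
  have small : ∀ {v : ι → A}, Tendsto v l (𝓝 0) → ∀ᶠ i in l, ‖v i‖ ≤ ε / 4 := fun hv =>
    (tendsto_zero_iff_norm_tendsto_zero.1 hv).eventually_le_const (by positivity)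
  have e₁ := (Finset.eventually_all F').2 fun y _ => small (hw (φ y))
  have e₂ := (Finset.eventually_all F).2 fun x _ => small (R.sum_const (φ x))
  have e₃ := (Finset.eventually_all F).2 fun x _ => eventually_all.2 fun h =>
    small (R.map_sum h fun g => innerAut (u g) (φ x))
  obtain ⟨i, h₁, h₂, h₃⟩ := (e₁.and (e₂.and e₃)).exists
  refine ⟨innerAut (w i), ⟨w i, rfl⟩, fun h x hx => ?_, fun x hx => ?_⟩
  · have hterm : ‖∑ g, f i (h * g) *
        (β h (innerAut (u g) (φ x)) - innerAut (u (h * g)) (φ (α h x)))‖ ≤ ε / 4 := by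
      calc _ ≤ ∑ _g : G, 2 * ε' := by
            refine norm_sum_le_of_le _ fun g _ => (norm_mul_le _ _).trans
              ((mul_le_of_le_one_left (norm_nonneg _) (R.norm_le i _)).trans ?_)
            have a₁ := hT g x (hFF' x hx)
            have a₂ := hT (h * g) _ (hF' h x hx)
            rw [← hα, mul_inv_rev, inv_mul_cancel_right, hβ] at a₂
            rw [← norm_aut_sub (β h)] at a₁
            rw [norm_sub_rev] at a₂
            have := norm_sub_le_norm_sub_add_norm_sub (β h (innerAut (u g) (φ x)))
              (β h (β g (φ (α g⁻¹ x)))) (innerAut (u (h * g)) (φ (α h x)))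
            linarith
        _ = ε / 4 := by
            rw [Finset.sum_const, nsmul_eq_mul, Finset.card_univ, ← hN]; linarith
    have hre : ∑ g, f i g * innerAut (u g) (φ (α h x)) =
        ∑ g, f i (h * g) * innerAut (u (h * g)) (φ (α h x)) :=
      (Equiv.sum_comp (Equiv.mulLeft h) fun g => f i g * innerAut (u g) (φ (α h x))).symm
    have b₁ := h₁ x (hFF' x hx)
    have b₂ := h₁ _ (hF' h x hx)
    have b₃ := h₃ x hx h
    rw [← norm_aut_sub (β h)] at b₁
    rw [hre, norm_sub_rev] at b₂
    rw [StarAlgEquiv.mul_apply, StarAlgEquiv.mul_apply]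
    simp only [mul_sub, Finset.sum_sub_distrib] at hterm
    refine (norm_sub_le_norm_sub_add_norm_sub _ (β h (∑ g, f i g * innerAut (u g) (φ x))) _).trans ?_
    refine (add_le_add b₁ (norm_sub_le_norm_sub_add_norm_sub _
      (∑ g, f i (h * g) * β h (innerAut (u g) (φ x))) _)).trans ?_
    refine (add_le_add le_rfl (add_le_add b₃ ((norm_sub_le_norm_sub_add_norm_sub _
      (∑ g, f i (h * g) * innerAut (u (h * g)) (φ (α h x))) _).trans
        (add_le_add hterm b₂)))).trans ?_
    linarith
  · have hterm : ‖∑ g, f i g * (innerAut (u g) (φ x) - φ x)‖ ≤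
        ε / 8 + ∑ g, ‖β g (φ (α g⁻¹ x)) - φ x‖ := by
      calc _ ≤ ∑ g : G, (ε' + ‖β g (φ (α g⁻¹ x)) - φ x‖) := by
            refine norm_sum_le_of_le _ fun g _ => (norm_mul_le _ _).trans
              ((mul_le_of_le_one_left (norm_nonneg _) (R.norm_le i _)).trans ?_)
            exact (norm_sub_le_norm_sub_add_norm_sub _ (β g (φ (α g⁻¹ x))) _).trans
              (add_le_add (hT g x (hFF' x hx)) le_rfl)
        _ = _ := by
            rw [Finset.sum_add_distrib, Finset.sum_const, nsmul_eq_mul, Finset.card_univ, ← hN, hNε]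
    simp only [mul_sub, Finset.sum_sub_distrib] at hterm
    have b₁ := h₁ x (hFF' x hx)
    have b₂ := h₂ x hx
    refine (norm_sub_le_norm_sub_add_norm_sub _ (∑ g, f i g * innerAut (u g) (φ x)) _).trans
      ((add_le_add b₁ ((norm_sub_le_norm_sub_add_norm_sub _ (∑ g, f i g * φ x) _).trans
        (add_le_add hterm b₂))).trans ?_)
    linarith

theorem ApproxInnerEquivariant.exists_almostEquivariant {ι : Type*} {l : Filter ι} [l.NeBot]
    {f : ι → G → A} (hα : IsAction α) (hβ : IsAction β) (R : IsRokhlinNet β l f)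
    (h : ApproxInnerEquivariant α β φ) {E : Finset A} {δ : ℝ}
    (hE : AlmostEquivariant β α φ⁻¹ E δ) (F : Finset A) {ε : ℝ} (hε : 0 < ε) :
    ∃ φ' : A ≃⋆ₐ[ℂ] A, ApproxInnerEquivariant α β φ' ∧ AlmostEquivariant α β φ' F ε ∧
      ∀ y ∈ E, ‖φ'⁻¹ y - φ⁻¹ y‖ ≤ ε + Fintype.card G * δ := by
  classical
  obtain ⟨σ, hσ, hF, hc⟩ := h.exists_inner hα hβ R (F ∪ E.image ⇑(φ⁻¹)) hε
  refine ⟨σ * φ, h.inner_mul hσ, fun g x hx => hF g x (Finset.mem_union_left _ hx),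
    fun y hy => ?_⟩
  have hy' := hc _ (Finset.mem_union_right _ (Finset.mem_image_of_mem ⇑(φ⁻¹) hy))
  rw [aut_apply_inv_self] at hy'
  rw [mul_inv_rev, StarAlgEquiv.mul_apply, norm_aut_sub, ← norm_aut_sub σ, aut_apply_inv_self,
    norm_sub_rev]
  refine hy'.trans (add_le_add le_rfl ?_)
  refine (Finset.sum_le_card_nsmul Finset.univ _ δ fun g _ => ?_).trans (by simp)
  have := hE g⁻¹ y hy
  rw [← norm_aut_sub φ, ← norm_aut_sub (β g), aut_apply_inv_self, hβ.apply_inv] at this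
  exact this

end AlmostEquivariance

section Intertwining

variable {A : Type*} [NonUnitalCStarAlgebra A]

theorem tendsto_aut_apply {ι : Type*} {l : Filter ι} {ρ : ι → A ≃⋆ₐ[ℂ] A} {u : ι → A} {a b : A}
    (hu : Tendsto u l (𝓝 a)) (ha : Tendsto (fun i => ρ i a) l (𝓝 b)) :
    Tendsto (fun i => ρ i (u i)) l (𝓝 b) := by
  have h : Tendsto (fun i => ρ i (u i) - ρ i a) l (𝓝 0) := by
    rw [tendsto_iff_norm_sub_tendsto_zero] at hu
    rw [tendsto_zero_iff_norm_tendsto_zero]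
    simpa only [norm_aut_sub] using hu
  simpa using h.add ha

theorem exists_tendsto_aut {ρ : ℕ → A ≃⋆ₐ[ℂ] A} {x : ℕ → A} (hx : DenseRange x) {C : ℝ}
    (h : ∀ n, ∀ i < n, ‖ρ (n + 1) (x i) - ρ n (x i)‖ ≤ C * (1 / 2) ^ n) (a : A) :
    ∃ b, Tendsto (fun n => ρ n a) atTop (𝓝 b) := by
  refine cauchySeq_tendsto_of_complete (Metric.cauchySeq_iff'.2 fun ε hε => ?_)
  obtain ⟨i, hi⟩ := hx.exists_dist_lt a (show (0 : ℝ) < ε / 3 by positivity)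
  have hc : CauchySeq fun n => ρ n (x i) := by
    refine cauchySeq_of_summable_dist ((summable_nat_add_iff (i + 1)).1 ?_)
    refine Summable.of_nonneg_of_le (fun _ => dist_nonneg) (fun n => ?_)
      ((summable_nat_add_iff (i + 1)).2 (summable_geometric_two.mul_left C))
    rw [dist_comm, dist_eq_norm]
    exact h _ i (by omega)
  obtain ⟨N, hN⟩ := Metric.cauchySeq_iff'.1 hc (ε / 3) (by positivity)
  refine ⟨N, fun n hn => ?_⟩
  have h₁ := hN n hn
  rw [dist_eq_norm] at hi h₁ ⊢
  have h₂ := norm_aut_sub (ρ n) a (x i)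
  have h₃ := norm_aut_sub (ρ N) (x i) a
  rw [norm_sub_rev (x i)] at h₃
  have h₄ := norm_sub_le_norm_sub_add_norm_sub (ρ n a) (ρ n (x i)) (ρ N a)
  have h₅ := norm_sub_le_norm_sub_add_norm_sub (ρ n (x i)) (ρ N (x i)) (ρ N a)
  linarith

theorem exists_limit_aut {ρ : ℕ → A ≃⋆ₐ[ℂ] A} {x : ℕ → A} (hx : DenseRange x) {C : ℝ}
    (h₁ : ∀ n, ∀ i < n, ‖ρ (n + 1) (x i) - ρ n (x i)‖ ≤ C * (1 / 2) ^ n)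
    (h₂ : ∀ n, ∀ i < n, ‖(ρ (n + 1))⁻¹ (x i) - (ρ n)⁻¹ (x i)‖ ≤ C * (1 / 2) ^ n) :
    ∃ θ : A ≃⋆ₐ[ℂ] A, ∀ a, Tendsto (fun n => ρ n a) atTop (𝓝 (θ a)) := by
  choose θ hθ using exists_tendsto_aut hx h₁
  choose θ' hθ' using exists_tendsto_aut (ρ := fun n => (ρ n)⁻¹) hx h₂
  refine ⟨
    { toFun := θ
      invFun := θ'
      left_inv := fun a => ?_
      right_inv := fun a => ?_
      map_add' := fun a b => ?_
      map_mul' := fun a b => ?_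
      map_star' := fun a => ?_
      map_smul' := fun c a => ?_ }, hθ⟩
  · refine tendsto_nhds_unique (tendsto_aut_apply (hθ a) (hθ' (θ a))) ?_
    simp only [aut_inv_apply_self, tendsto_const_nhds]
  · refine tendsto_nhds_unique (tendsto_aut_apply (hθ' a) (hθ (θ' a))) ?_
    simp only [aut_apply_inv_self, tendsto_const_nhds]
  · exact tendsto_nhds_unique (hθ _) (by simpa only [map_mul] using (hθ a).mul (hθ b))
  · exact tendsto_nhds_unique (hθ _) (by simpa only [map_add] using (hθ a).add (hθ b))
  · exact tendsto_nhds_unique (hθ _) (by simpa only [map_star] using (hθ a).star)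
  · exact tendsto_nhds_unique (hθ _) (by simpa only [map_smul] using (hθ a).const_smul c)

theorem exists_seq_of_step {X : Type*} {P : ℕ → X → Prop} {Q : ℕ → X → X → Prop}
    {x₀ : X} (h₀ : P 0 x₀) (step : ∀ n x, P n x → ∃ y, P (n + 1) y ∧ Q n x y) :
    ∃ s : ℕ → X, (∀ n, P n (s n)) ∧ ∀ n, Q n (s n) (s (n + 1)) := by
  choose next hP hQ using step
  let s : ∀ n, {x // P n x} := fun n =>
    Nat.rec ⟨x₀, h₀⟩ (fun n x => ⟨next n x.1 x.2, hP n x.1 x.2⟩) n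
  exact ⟨fun n => (s n).1, fun n => (s n).2, fun n => hQ n (s n).1 (s n).2⟩

variable {G : Type*} {α β : G → A ≃⋆ₐ[ℂ] A}

/-- The state of the back-and-forth construction: `ρ` almost intertwines `α` and `β` on a finite
set containing `D` and, up to `δ`, the preimage of `D` under `ρ`. -/
def IntertwiningState (α β : G → A ≃⋆ₐ[ℂ] A) (D : Finset A) (δ : ℝ) (ρ : A ≃⋆ₐ[ℂ] A) : Prop :=
  ApproxInnerEquivariant α β ρ ∧ ∃ E : Finset A, D ⊆ E ∧ (∀ x ∈ D, ∃ e ∈ E, ‖ρ⁻¹ x - e‖ ≤ δ) ∧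
    AlmostEquivariant α β ρ E δ

variable [Group G] [Fintype G]

theorem IntertwiningState.exists_next {ι κ : Type*} {l : Filter ι} {m : Filter κ} [l.NeBot]
    [m.NeBot] {f : ι → G → A} {k : κ → G → A} (hα : IsAction α) (hβ : IsAction β)
    (Rα : IsRokhlinNet α l f) (Rβ : IsRokhlinNet β m k) {D : Finset A} {δ : ℝ}
    {ρ : A ≃⋆ₐ[ℂ] A} (h : IntertwiningState α β D δ ρ) (D' : Finset A) {δ' : ℝ} (hδ' : 0 < δ') :
    ∃ ρ' : A ≃⋆ₐ[ℂ] A, IntertwiningState α β D' δ' ρ' ∧ ∀ x ∈ D,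
      ‖ρ' x - ρ x‖ ≤ 2 * δ' + (Fintype.card G + 2) * δ ∧
      ‖ρ'⁻¹ x - ρ⁻¹ x‖ ≤ 2 * δ' + (Fintype.card G + 2) * δ := by
  classical
  obtain ⟨hρ, E, hDE, hE, hEq⟩ := h
  set N : ℝ := (Fintype.card G : ℝ) with hN
  have hN0 : 0 ≤ N := by positivity
  set ε : ℝ := δ' / (1 + N) with hε
  have hε0 : 0 < ε := by positivity
  have hNε : ε + N * ε = δ' := by rw [hε]; field_simp
  obtain ⟨τ, hτ, hτF, hτE⟩ := hρ.inv.exists_almostEquivariant hβ hα Rα (E := E) (δ := δ)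
    (by rwa [inv_inv]) (D ∪ D' ∪ D.image ρ) hε0
  rw [inv_inv, ← hN] at hτE
  obtain ⟨ρ', hρ', hρ'E, hρ'F⟩ := hτ.inv.exists_almostEquivariant hα hβ Rβ
    (E := D ∪ D' ∪ D.image ρ) (δ := ε) (by rwa [inv_inv]) (D' ∪ D'.image τ) hε0
  rw [inv_inv, ← hN, hNε] at hρ'F
  refine ⟨ρ', ⟨hρ', D' ∪ D'.image τ, Finset.subset_union_left, fun x hx => ⟨τ x, ?_, ?_⟩, ?_⟩,
    fun x hx => ⟨?_, ?_⟩⟩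
  · exact Finset.mem_union_right _ (Finset.mem_image_of_mem _ hx)
  · exact hρ'F x (Finset.mem_union_left _ (Finset.mem_union_right _ hx))
  · exact fun g x hx => (hρ'E g x hx).trans (by nlinarith)
  · have h₁ := hρ'F (ρ x) (Finset.mem_union_right _ (Finset.mem_image_of_mem _ hx))
    have h₂ := hτE x (hDE hx)
    rw [← norm_aut_sub ρ', aut_apply_inv_self] at h₁
    rw [← norm_aut_sub τ, aut_apply_inv_self, ← norm_aut_sub ρ'] at h₂
    have h₃ := norm_sub_le_norm_sub_add_norm_sub (ρ' x) (ρ' (τ (ρ x))) (ρ x)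
    rw [norm_sub_rev (ρ' (τ (ρ x)))] at h₃
    have h₄ : 0 ≤ δ := (norm_nonneg _).trans (hE x hx).choose_spec.2
    nlinarith
  · obtain ⟨e, he, hxe⟩ := hE x hx
    have h₁ := hρ'F x (Finset.mem_union_left _ (Finset.mem_union_left _ hx))
    have h₂ := hτE e he
    have h₃ := hxe
    rw [← norm_aut_sub ρ, aut_apply_inv_self, ← norm_aut_sub τ, norm_sub_rev] at h₃
    rw [← norm_aut_sub τ, aut_apply_inv_self] at h₂
    have h₄ := norm_sub_le_norm_sub_add_norm_sub (ρ'⁻¹ x) (τ x) (ρ⁻¹ x)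
    have h₅ := norm_sub_le_norm_sub_add_norm_sub (τ x) (τ (ρ e)) (ρ⁻¹ x)
    have h₆ := norm_sub_le_norm_sub_add_norm_sub (τ (ρ e)) e (ρ⁻¹ x)
    rw [norm_sub_rev (τ x) (τ (ρ e))] at h₅
    rw [norm_sub_rev (τ (ρ e)) e, norm_sub_rev e (ρ⁻¹ x)] at h₆
    nlinarith

theorem exists_equivariant_aut [TopologicalSpace.SeparableSpace A] {ι κ : Type*} {l : Filter ι}
    {m : Filter κ} [l.NeBot] [m.NeBot] {f : ι → G → A} {k : κ → G → A} (hα : IsAction α)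
    (hβ : IsAction β) (Rα : IsRokhlinNet α l f) (Rβ : IsRokhlinNet β m k) {φ : A ≃⋆ₐ[ℂ] A}
    (h : ApproxInnerEquivariant α β φ) :
    ∃ θ : A ≃⋆ₐ[ℂ] A, ∀ g a, β g (θ a) = θ (α g a) := by
  classical
  set x : ℕ → A := TopologicalSpace.denseSeq A
  have hx : DenseRange x := TopologicalSpace.denseRange_denseSeq A
  obtain ⟨ρ, hρ, hρQ⟩ := exists_seq_of_step
    (P := fun n => IntertwiningState α β ((Finset.range n).image x) ((1 / 2) ^ n))
    (x₀ := φ) ⟨h, ∅, by simp, by simp, fun g x hx => by simp at hx⟩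
    fun n ρ hρ => hρ.exists_next hα hβ Rα Rβ ((Finset.range (n + 1)).image x)
      (δ' := (1 / 2) ^ (n + 1)) (by positivity)
  have hC : ∀ n : ℕ, 2 * (1 / 2 : ℝ) ^ (n + 1) + (Fintype.card G + 2) * (1 / 2) ^ n =
      (Fintype.card G + 3) * (1 / 2) ^ n := fun n => by ring
  have hmem : ∀ n, ∀ i < n, x i ∈ (Finset.range n).image x := fun n i hi =>
    Finset.mem_image_of_mem _ (Finset.mem_range.2 hi)
  simp only [hC] at hρQ
  obtain ⟨θ, hθ⟩ := exists_limit_aut hx (fun n i hi => (hρQ n _ (hmem n i hi)).1)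
    (fun n i hi => (hρQ n _ (hmem n i hi)).2)
  have hiso : ∀ σ : A ≃⋆ₐ[ℂ] A, Continuous σ := fun σ =>
    (AddMonoidHomClass.isometry_of_norm σ (norm_aut σ)).continuous
  refine ⟨θ, fun g => congrFun (hx.equalizer ((hiso _).comp (hiso _)) ((hiso _).comp (hiso _))
    (funext fun i => ?_))⟩
  have h₀ : Tendsto (fun n => β g (ρ n (x i)) - ρ n (α g (x i))) atTop (𝓝 0) := by
    refine squeeze_zero_norm' ?_ (tendsto_pow_atTop_nhds_zero_of_lt_one
      (show (0 : ℝ) ≤ 1 / 2 by norm_num) (by norm_num))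
    filter_upwards [eventually_gt_atTop i] with n hn
    obtain ⟨-, E, hDE, -, hE⟩ := hρ n
    exact hE g _ (hDE (hmem n i hn))
  have h₁ := (((hiso (β g)).tendsto _).comp (hθ (x i))).sub (hθ (α g (x i)))
  exact sub_eq_zero.1 (tendsto_nhds_unique h₁ h₀)

end Intertwining

theorem ApproxUnitarilyEquiv.exists_inner {A : Type*} [NonUnitalCStarAlgebra A] {γ : A → A}
    {γ' : A → A} (h : ApproxUnitarilyEquiv γ γ') (F : Finset A) {ε : ℝ} (hε : 0 < ε) :
    ∃ σ ∈ innerAutSubgroup A, ∀ a ∈ F, ‖σ (γ a) - γ' a‖ ≤ ε := by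
  obtain ⟨u, hu⟩ := h
  obtain ⟨n, hn⟩ := ((Finset.eventually_all F).2 fun a _ => (hu a).eventually_le_const hε).exists
  refine ⟨innerAut (u n), ⟨u n, rfl⟩, fun a ha => ?_⟩
  rw [← Unitization.norm_inr (𝕜 := ℂ), Unitization.inr_sub, inr_innerAut]
  exact hn a ha

/-- If two Rokhlin actions `α₀, α₁` of a finite group on a separable C⋆-algebra are pointwise
approximately unitarily equivalent after conjugating by a single automorphism `ψ`, then they
are conjugate. -/
theorem rokhlin_cocycle_conjugate_of_conjugate_up_to_ue
    {G A : Type*} [Group G] [Fintype G] [NonUnitalCStarAlgebra A]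
    [PartialOrder A] [StarOrderedRing A] [TopologicalSpace.SeparableSpace A]
    (α₀ α₁ : G → A ≃⋆ₐ[ℂ] A) (hα₀ : IsAction α₀) (hα₁ : IsAction α₁)
    (hRok₀ : RokhlinProperty α₀) (hRok₁ : RokhlinProperty α₁)
    (ψ : A ≃⋆ₐ[ℂ] A)
    (hue : ∀ g : G, ApproxUnitarilyEquiv (⇑(α₁ g)) (fun a => ψ (α₀ g (ψ.symm a)))) :
    ∃ θ : A ≃⋆ₐ[ℂ] A, ∀ (g : G) (a : A), α₁ g a = θ (α₀ g (θ.symm a)) := by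
  classical
  obtain ⟨f₀, R₀⟩ := hRok₀.exists_isRokhlinNet
  obtain ⟨f₁, R₁⟩ := hRok₁.exists_isRokhlinNet
  have h : ApproxInnerEquivariant α₀ α₁ ψ := fun g F ε hε => by
    obtain ⟨σ, hσ, hF⟩ := (hue g).exists_inner (F.image ψ) hε
    refine ⟨σ⁻¹, inv_mem hσ, fun x hx => ?_⟩
    have := hF _ (Finset.mem_image_of_mem _ hx)
    rw [StarAlgEquiv.symm_apply_apply] at this
    rwa [← norm_aut_sub σ, aut_apply_inv_self, norm_sub_rev]
  obtain ⟨θ, hθ⟩ := exists_equivariant_aut hα₀ hα₁ R₀ R₁ h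
  exact ⟨θ, fun g a => by rw [← hθ, StarAlgEquiv.apply_symm_apply]⟩
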